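/- arXiv:1609.00251 — 3 statements merged into one kernel-verified Lean document; each statement's English description precedes it below -/
import Mathlib

section
/- Let $(f_n)_{n\in\mathbb{N}}$ be a sequence of continuous real-valued functions on a compact set $K\subset\mathbb{R}$ converging uniformly on $K$ to $f$. Let $(I_n)_{n\in\mathbb{N}}$ and $I$ be nonempty compact subsets of $K$ such that the Hausdorff distance between $I_n$ and $I$ tends to $0$ as $n\to\infty$. Assume $f$ has a unique global maximum point $c$ on $I$, and for each $n$ let $c_n$ be a point of $I_n$ at which $f_n$ attains its maximum over $I_n$. Then $c_n\to c$ as $n\to\infty$. -/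
open Filter

theorem argmax_tendsto_of_uniform_and_hausdorff
    (K : Set ℝ) (hK : IsCompact K)
    (fn : ℕ → ℝ → ℝ) (f : ℝ → ℝ)
    (hcont : ∀ n, ContinuousOn (fn n) K)
    (hunif : TendstoUniformlyOn fn f atTop K)
    (In : ℕ → Set ℝ) (I : Set ℝ)
    (hIne : I.Nonempty) (hIcomp : IsCompact I) (hIK : I ⊆ K)
    (hInne : ∀ n, (In n).Nonempty) (hIncomp : ∀ n, IsCompact (In n))
    (hInK : ∀ n, In n ⊆ K)
    (hHaus : Tendsto (fun n => Metric.hausdorffDist (In n) I) atTop (nhds 0))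
    (c : ℝ) (hcI : c ∈ I) (hcmax : ∀ x ∈ I, f x ≤ f c)
    (hcuniq : ∀ x ∈ I, (∀ y ∈ I, f y ≤ f x) → x = c)
    (cn : ℕ → ℝ) (hcnI : ∀ n, cn n ∈ In n)
    (hcnmax : ∀ n, ∀ x ∈ In n, fn n x ≤ fn n (cn n)) :
    Tendsto cn atTop (nhds c) := by
  have hf : ContinuousOn f K := hunif.continuousOn (Frequently.of_forall hcont)
  have huc := hK.uniformContinuousOn_of_continuous hf
  rw [Metric.uniformContinuousOn_iff] at huc
  rw [Metric.tendstoUniformlyOn_iff] at hunif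
  have hfin : ∀ n, Metric.hausdorffEDist (In n) I ≠ ⊤ := fun n =>
    Metric.hausdorffEDist_ne_top_of_nonempty_of_bounded (hInne n) hIne
      (hIncomp n).isBounded hIcomp.isBounded
  rw [Metric.tendsto_nhds]
  intro ε hε
  have hgap : ∃ m > 0, ∀ x ∈ I, f c - m < f x → dist x c < ε / 2 := by
    have hJ : IsCompact (I \ Metric.ball c (ε / 2)) := hIcomp.diff Metric.isOpen_ball
    rcases (I \ Metric.ball c (ε / 2)).eq_empty_or_nonempty with he | hne
    · refine ⟨1, one_pos, fun x hx _ => ?_⟩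
      by_contra h
      have : x ∈ I \ Metric.ball c (ε / 2) := ⟨hx, h⟩
      rw [he] at this
      exact this
    · obtain ⟨x0, hx0, hmax⟩ := hJ.exists_isMaxOn hne
        (hf.mono (Set.diff_subset.trans hIK))
      have hlt : f x0 < f c := by
        by_contra h
        have h2 := hcuniq x0 hx0.1 (fun y hy => (hcmax y hy).trans (not_lt.1 h))
        apply hx0.2
        rw [h2]
        exact Metric.mem_ball_self (half_pos hε)
      refine ⟨f c - f x0, by linarith, fun x hx h => ?_⟩
      by_contra h3
      have : f x ≤ f x0 := hmax (show x ∈ I \ Metric.ball c (ε / 2) from ⟨hx, h3⟩)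
      linarith
  obtain ⟨m, hm, hgap⟩ := hgap
  obtain ⟨δ, hδ, huc⟩ := huc (m / 4) (by linarith)
  have hr : 0 < min δ (ε / 2) := lt_min hδ (half_pos hε)
  filter_upwards [hunif (m / 4) (by linarith), hHaus.eventually (gt_mem_nhds hr)] with n h1 h2
  obtain ⟨y, hyI, hy⟩ := Metric.exists_dist_lt_of_hausdorffDist_lt (hcnI n) h2 (hfin n)
  obtain ⟨z, hzI, hz⟩ := Metric.exists_dist_lt_of_hausdorffDist_lt' hcI h2 (hfin n)
  have a1 := huc _ (hInK n (hcnI n)) y (hIK hyI) (hy.trans_le (min_le_left _ _))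
  have a2 := huc _ (hInK n hzI) c (hIK hcI) (hz.trans_le (min_le_left _ _))
  have a3 := h1 _ (hInK n (hcnI n))
  have a4 := h1 _ (hInK n hzI)
  have a5 := hcnmax n z hzI
  rw [Real.dist_eq, abs_lt] at a1 a2 a3 a4
  have a6 := hgap y hyI (by linarith [a1.1, a1.2, a2.1, a2.2, a3.1, a3.2, a4.1, a4.2])
  have a7 := hy.trans_le (min_le_right _ _)
  linarith [dist_triangle (cn n) y c]
end

section
/- Define $g:\mathbb{R}\to\mathbb{R}$ by $g(\xi)=\tfrac12\big(\sqrt{e^{4\xi}+4e^{2\xi}}-e^{2\xi}\big)$. Let $J,h\in\mathbb{R}$ and $m\in(0,1)$ satisfy the consistency equation $m=g((2m-1)J+h)$, set $\xi=(2m-1)J+h$, assume $1-2J\,g'(\xi)\neq 0$, and let $\chi=\dfrac{g'(\xi)}{1-2J\,g'(\xi)}$, with $\chi\neq 0$. Then the imitation coefficient is recovered by the inverse formula $J=-\dfrac{1}{2\chi}+\dfrac{2-m}{4m(1-m)}$. -/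
noncomputable def g (ξ : ℝ) : ℝ :=
  (1 / 2) * (Real.sqrt (Real.exp (4 * ξ) + 4 * Real.exp (2 * ξ)) - Real.exp (2 * ξ))

theorem deriv_g_eq (ξ m : ℝ) (hm0 : 0 < m) (hm1 : m < 1) (hcons : m = g ξ) :
    deriv g ξ = 2 * m * (1 - m) / (2 - m) := by
  have hE : 0 < Real.exp (2 * ξ) := Real.exp_pos _
  have h4 : Real.exp (4 * ξ) = Real.exp (2 * ξ) ^ 2 := by
    rw [← Real.exp_nat_mul]; congr 1; push_cast; ring
  have hpos : 0 < Real.exp (4 * ξ) + 4 * Real.exp (2 * ξ) := by positivity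
  have d4 : HasDerivAt (fun x : ℝ => Real.exp (4 * x)) (Real.exp (4 * ξ) * (4 * 1)) ξ :=
    ((hasDerivAt_id ξ).const_mul 4).exp
  have d2 : HasDerivAt (fun x : ℝ => Real.exp (2 * x)) (Real.exp (2 * ξ) * (2 * 1)) ξ :=
    ((hasDerivAt_id ξ).const_mul 2).exp
  have hd := (((d4.add (d2.const_mul 4)).sqrt hpos.ne').sub d2).const_mul (1 / 2 : ℝ)
  have hd' : deriv g ξ = _ := HasDerivAt.deriv (f := g) hd
  rw [hd']
  simp only [Pi.add_apply]
  have hs := Real.sq_sqrt hpos.le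
  have hsp := Real.sqrt_pos.mpr hpos
  unfold g at hcons
  generalize Real.sqrt (Real.exp (4 * ξ) + 4 * Real.exp (2 * ξ)) = s at *
  rw [h4] at hs ⊢
  generalize Real.exp (2 * ξ) = E at *
  have h1 : (1 - m) ≠ 0 := by linarith
  have h2 : (2 - m) ≠ 0 := by linarith
  have hsE : s = 2 * m + E := by linarith
  have hEm : E = m ^ 2 / (1 - m) := by
    rw [eq_div_iff h1]; subst hsE; nlinarith
  have hsm : s = m * (2 - m) / (1 - m) := by
    rw [hsE, hEm]; field_simp; ring
  rw [hsm, hEm]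
  field_simp
  ring

theorem inverse_formula_J (J h m ξ χ : ℝ) (hm : m ∈ Set.Ioo (0 : ℝ) 1)
    (hξ : ξ = (2 * m - 1) * J + h) (hcons : m = g ξ)
    (hden : 1 - 2 * J * deriv g ξ ≠ 0)
    (hχ : χ = deriv g ξ / (1 - 2 * J * deriv g ξ)) (hχ0 : χ ≠ 0) :
    J = -(1 / (2 * χ)) + (2 - m) / (4 * m * (1 - m)) := by
  obtain ⟨h0, h1⟩ := hm
  have hd := deriv_g_eq ξ m h0 h1 hcons
  have a1 : (1 - m) ≠ 0 := by linarith
  have a2 : (2 - m) ≠ 0 := by linarith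
  have hD : deriv g ξ ≠ 0 := by
    intro h; apply hχ0; rw [hχ, h]; simp
  have e1 : (2 - m) / (4 * m * (1 - m)) = 1 / (2 * deriv g ξ) := by
    rw [hd]; field_simp; norm_num
  rw [e1, hχ]
  generalize deriv g ξ = D at *
  field_simp
  ring
end

section
/- Define $g:\mathbb{R}\to\mathbb{R}$ by $g(\xi)=\tfrac12\big(\sqrt{e^{4\xi}+4e^{2\xi}}-e^{2\xi}\big)$. Let $J,h\in\mathbb{R}$ and $m\in(0,1)$ satisfy the consistency equation $m=g((2m-1)J+h)$. Then the external field is recovered by the inverse formula $h=\tfrac12\log\Big(\dfrac{m^2}{1-m}\Big)-J(2m-1)$. -/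
theorem inverse_formula_h (J h m : ℝ) (hm : m ∈ Set.Ioo (0 : ℝ) 1)
    (hcons : m = g ((2 * m - 1) * J + h)) :
    h = (1 / 2) * Real.log (m ^ 2 / (1 - m)) - J * (2 * m - 1) := by
  obtain ⟨h0, h1⟩ := hm
  generalize hξ : (2 * m - 1) * J + h = ξ at hcons
  unfold g at hcons
  have e4 : Real.exp (4 * ξ) = Real.exp (2 * ξ) ^ 2 := by
    rw [← Real.exp_nat_mul]; congr 1; push_cast; ring
  have hp := Real.exp_pos (2 * ξ)
  have hs := Real.sq_sqrt (show 0 ≤ Real.exp (4 * ξ) + 4 * Real.exp (2 * ξ) by positivity)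
  have hr : Real.sqrt (Real.exp (4 * ξ) + 4 * Real.exp (2 * ξ)) = 2 * m + Real.exp (2 * ξ) := by
    linarith
  rw [hr, e4] at hs
  have hq : m ^ 2 / (1 - m) = Real.exp (2 * ξ) := by
    rw [div_eq_iff (by linarith)]
    nlinarith
  rw [hq, Real.log_exp]
  linarith
end
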